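/- For integers m, n ≥ 1, the integral over all real m×n matrices Z of (det(1ₘ + Z Zᵀ))^(−(m+n)/2) with respect to Lebesgue measure equals π^(mn/2) · ∏_{j=1}^{n} Γ(j/2)/Γ((m+j)/2). -/

import Mathlib

open MeasureTheory Matrix
open scoped ENNReal Real

lemma lintegral_rpow_mul_exp_neg_mul_Ioi {a r : ℝ} (ha : 0 < a) (hr : 0 < r) :
    ∫⁻ t in Set.Ioi (0 : ℝ), ENNReal.ofReal (t ^ (a - 1) * Real.exp (-(r * t))) =
      ENNReal.ofReal ((1 / r) ^ a * Real.Gamma a) := by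
  have hval := Real.integral_rpow_mul_exp_neg_mul_Ioi ha hr
  have hpos : 0 < (1 / r) ^ a * Real.Gamma a :=
    mul_pos (Real.rpow_pos_of_pos (by positivity) _) (Real.Gamma_pos_of_pos ha)
  rw [← ofReal_integral_eq_lintegral_ofReal
    (Integrable.of_integral_ne_zero (hval.trans_ne hpos.ne')), hval]
  filter_upwards [ae_restrict_mem measurableSet_Ioi] with t ht
  have : (0 : ℝ) < t := ht
  positivity

lemma lintegral_exp_neg_mul_dotProduct_self {ι : Type*} [Fintype ι] {b : ℝ} (hb : 0 < b) :
    ∫⁻ y : ι → ℝ, ENNReal.ofReal (Real.exp (-(b * (y ⬝ᵥ y)))) =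
      ENNReal.ofReal ((π / b) ^ ((Fintype.card ι : ℝ) / 2)) := by
  have hval := GaussianFourier.integral_rexp_neg_mul_sq_norm (V := EuclideanSpace ℝ ι) hb
  have hpos : 0 < (π / b) ^ ((Module.finrank ℝ (EuclideanSpace ℝ ι) : ℝ) / 2) :=
    Real.rpow_pos_of_pos (by positivity) _
  have hlint := ofReal_integral_eq_lintegral_ofReal
    (Integrable.of_integral_ne_zero (hval.trans_ne hpos.ne'))
    (ae_of_all _ fun _ => (Real.exp_pos _).le)
  rw [hval, finrank_euclideanSpace] at hlint
  rw [hlint, ← (PiLp.volume_preserving_toLp ι).lintegral_comp (by fun_prop)]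
  simp only [EuclideanSpace.real_norm_sq_eq]
  simp only [dotProduct, sq, neg_mul]

/-- The `m`-variate Cauchy-type integral `∫ (1 + |y|²)^(-a) dy = π^(m/2) Γ(a - m/2) / Γ(a)`. -/
lemma lintegral_one_add_dotProduct_self_rpow {ι : Type*} [Fintype ι] {a : ℝ}
    (ha : (Fintype.card ι : ℝ) / 2 < a) :
    ∫⁻ y : ι → ℝ, ENNReal.ofReal ((1 + y ⬝ᵥ y) ^ (-a)) =
      ENNReal.ofReal (π ^ ((Fintype.card ι : ℝ) / 2) *
        (Real.Gamma (a - (Fintype.card ι : ℝ) / 2) / Real.Gamma a)) := by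
  set c : ℝ := (Fintype.card ι : ℝ) / 2 with hc
  have hc0 : 0 ≤ c := by positivity
  have ha0 : 0 < a := hc0.trans_lt ha
  have hΓ : 0 < Real.Gamma a := Real.Gamma_pos_of_pos ha0
  have hdot (y : ι → ℝ) : 0 ≤ y ⬝ᵥ y := Finset.sum_nonneg fun i _ => mul_self_nonneg _
  have hcont : Continuous fun y : ι → ℝ => y ⬝ᵥ y := continuous_id.dotProduct continuous_id
  have key : ENNReal.ofReal (Real.Gamma a) *
      ∫⁻ y : ι → ℝ, ENNReal.ofReal ((1 + y ⬝ᵥ y) ^ (-a)) =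
      ENNReal.ofReal (π ^ c * Real.Gamma (a - c)) := by
    calc
      _ = ∫⁻ y : ι → ℝ, ∫⁻ t in Set.Ioi (0 : ℝ),
            ENNReal.ofReal (t ^ (a - 1) * Real.exp (-((1 + y ⬝ᵥ y) * t))) := by
        rw [← lintegral_const_mul' _ _ ENNReal.ofReal_ne_top]
        refine lintegral_congr fun y => ?_
        have hy : 0 < 1 + y ⬝ᵥ y := by linarith [hdot y]
        rw [lintegral_rpow_mul_exp_neg_mul_Ioi ha0 hy, ← ENNReal.ofReal_mul hΓ.le, one_div,
          Real.inv_rpow hy.le, ← Real.rpow_neg hy.le, mul_comm]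
      _ = ∫⁻ t in Set.Ioi (0 : ℝ), ∫⁻ y : ι → ℝ,
            ENNReal.ofReal (t ^ (a - 1) * Real.exp (-((1 + y ⬝ᵥ y) * t))) := by
        refine lintegral_lintegral_swap (Measurable.aemeasurable ?_)
        have := hcont.measurable
        fun_prop
      _ = ∫⁻ t in Set.Ioi (0 : ℝ),
            ENNReal.ofReal (π ^ c) *
              ENNReal.ofReal (t ^ (a - c - 1) * Real.exp (-(1 * t))) := by
        refine setLIntegral_congr_fun measurableSet_Ioi fun t ht => ?_
        have ht : 0 < t := ht
        have hsplit (y : ι → ℝ) :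
            ENNReal.ofReal (t ^ (a - 1) * Real.exp (-((1 + y ⬝ᵥ y) * t))) =
            ENNReal.ofReal (t ^ (a - 1) * Real.exp (-(1 * t))) *
              ENNReal.ofReal (Real.exp (-(t * (y ⬝ᵥ y)))) := by
          rw [← ENNReal.ofReal_mul (by positivity), mul_assoc, ← Real.exp_add]
          ring_nf
        simp only [hsplit]
        rw [lintegral_const_mul' _ _ ENNReal.ofReal_ne_top,
          lintegral_exp_neg_mul_dotProduct_self ht, ← hc,
          ← ENNReal.ofReal_mul (by positivity), ← ENNReal.ofReal_mul (by positivity),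
          Real.div_rpow Real.pi_pos.le ht.le, sub_right_comm, Real.rpow_sub ht _ c]
        ring_nf
      _ = _ := by
        rw [lintegral_const_mul' _ _ ENNReal.ofReal_ne_top,
          lintegral_rpow_mul_exp_neg_mul_Ioi (sub_pos.2 ha) one_pos,
          ← ENNReal.ofReal_mul (by positivity)]
        simp
  rw [← mul_div_assoc, ENNReal.ofReal_div_of_pos hΓ,
    ENNReal.eq_div_iff (by simpa using hΓ) ENNReal.ofReal_ne_top, key]

lemma lintegral_comp_mulVec {ι : Type*} [Fintype ι] [DecidableEq ι] {M : Matrix ι ι ℝ}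
    (hM : M.det ≠ 0) {f : (ι → ℝ) → ℝ≥0∞} (hf : Measurable f) :
    ∫⁻ z, f z = ENNReal.ofReal |M.det| * ∫⁻ y, f (M *ᵥ y) := by
  have hmap := lintegral_map (μ := volume) hf
    (LinearMap.continuous_of_finiteDimensional (toLin' M)).measurable
  rw [Real.map_matrix_volume_pi_eq_smul_volume_pi hM, lintegral_smul_measure] at hmap
  simp only [toLin'_apply, smul_eq_mul] at hmap
  rw [← hmap, ← mul_assoc, ← ENNReal.ofReal_mul (abs_nonneg _), ← abs_mul, mul_inv_cancel₀ hM]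
  simp

open scoped MatrixOrder in
lemma Matrix.PosDef.exists_eq_transpose_mul_self {ι : Type*} [Fintype ι] [DecidableEq ι]
    {A : Matrix ι ι ℝ} (hA : A.PosDef) : ∃ B : Matrix ι ι ℝ, A = Bᵀ * B := by
  obtain ⟨B, hB⟩ := CStarAlgebra.nonneg_iff_eq_star_mul_self.mp hA.posSemidef.nonneg
  exact ⟨B, by rw [hB, star_eq_conjTranspose, conjTranspose_eq_transpose_of_trivial]⟩

lemma lintegral_det_add_vecMulVec_self_rpow {ι : Type*} [Fintype ι] [DecidableEq ι]
    {A : Matrix ι ι ℝ} (hA : A.PosDef) {a : ℝ} (ha : (Fintype.card ι : ℝ) / 2 < a) :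
    ∫⁻ z : ι → ℝ, ENNReal.ofReal (det (A + vecMulVec z z) ^ (-a)) =
      ENNReal.ofReal (π ^ ((Fintype.card ι : ℝ) / 2) *
        (Real.Gamma (a - (Fintype.card ι : ℝ) / 2) / Real.Gamma a)) *
        ENNReal.ofReal (det A ^ (-(a - 1 / 2))) := by
  have hdet := hA.det_pos
  obtain ⟨B, hB⟩ := hA.exists_eq_transpose_mul_self
  have hdetB : det A = |det B| ^ (2 : ℝ) := by
    rw [hB, det_mul, det_transpose]; simp [sq]
  have hB0 : Bᵀ.det ≠ 0 := by
    rw [det_transpose]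
    rintro h
    simp [hdetB, h] at hdet
  have habs : 0 < |det B| := by rw [det_transpose] at hB0; positivity
  have hmeas : Measurable fun z : ι → ℝ =>
      ENNReal.ofReal (det (A + vecMulVec z z) ^ (-a)) := by
    have hc : Continuous fun z : ι → ℝ => det (A + vecMulVec z z) :=
      (continuous_const.add (continuous_id.matrix_vecMulVec continuous_id)).matrix_det
    have := hc.measurable
    fun_prop
  have hfac (y : ι → ℝ) :
      det (A + vecMulVec (Bᵀ *ᵥ y) (Bᵀ *ᵥ y)) = det A * (1 + y ⬝ᵥ y) := by
    have : A + vecMulVec (Bᵀ *ᵥ y) (Bᵀ *ᵥ y) =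
        Bᵀ * (1 + replicateCol Unit y * replicateRow Unit y) * B := by
      rw [hB, ← vecMulVec_eq, Matrix.mul_add, Matrix.add_mul, Matrix.mul_one, mul_vecMulVec,
        vecMulVec_mul, mulVec_transpose]
    rw [this, det_mul, det_mul, det_one_add_replicateCol_mul_replicateRow, hB, det_mul]
    ring
  have hdot (y : ι → ℝ) : 0 ≤ 1 + y ⬝ᵥ y :=
    add_nonneg zero_le_one (Finset.sum_nonneg fun i _ => mul_self_nonneg _)
  rw [lintegral_comp_mulVec hB0 hmeas, det_transpose]
  simp only [hfac]
  simp only [Real.mul_rpow hdet.le (hdot _), ENNReal.ofReal_mul (Real.rpow_nonneg hdet.le _)]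
  rw [lintegral_const_mul' _ _ ENNReal.ofReal_ne_top, lintegral_one_add_dotProduct_self_rpow ha,
    ← mul_assoc, ← ENNReal.ofReal_mul habs.le, mul_comm]
  congr 2
  rw [hdetB, ← Real.rpow_mul habs.le, ← Real.rpow_mul habs.le]
  nth_rewrite 1 [← Real.rpow_one |det B|]
  rw [← Real.rpow_add habs]
  ring_nf

lemma measurePreserving_splitFirstColumn (m n : ℕ) :
    MeasurePreserving (fun Z : Fin m → Fin (n + 1) → ℝ =>
      ((fun i => Z i 0, fun i j => Z i j.succ) : (Fin m → ℝ) × (Fin m → Fin n → ℝ)))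
      volume volume :=
  (volume_measurePreserving_arrowProdEquivProdArrow ℝ (Fin n → ℝ) (Fin m)).comp
    (volume_preserving_pi fun _ => volume_preserving_piFinSuccAbove (fun _ : Fin (n + 1) => ℝ) 0)

lemma lintegral_det_one_add_mul_transpose_rpow (m n : ℕ) :
    (∫⁻ Z : Fin m → Fin n → ℝ,
        ENNReal.ofReal
          (Matrix.det (1 + Matrix.of Z * (Matrix.of Z)ᵀ) ^ (-((m : ℝ) + n) / 2)))
      = ENNReal.ofReal (Real.pi ^ ((m * n : ℝ) / 2) *
          ∏ j ∈ Finset.range n,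
            Real.Gamma (((j + 1) : ℝ) / 2) / Real.Gamma ((m + (j + 1) : ℝ) / 2)) := by
  induction n with
  | zero => simp [volume_pi, Measure.pi_univ]
  | succ n ih =>
    set a : ℝ := ((m : ℝ) + (n + 1)) / 2 with ha
    have hexp : -((m : ℝ) + ((n + 1 : ℕ) : ℝ)) / 2 = -a := by push_cast; rw [ha]; ring
    have hsplit (Z : Fin m → Fin (n + 1) → ℝ) :
        1 + of Z * (of Z)ᵀ = (1 + of (fun i (j : Fin n) => Z i j.succ) *
          (of (fun i (j : Fin n) => Z i j.succ))ᵀ) +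
          vecMulVec (fun i => Z i 0) (fun i => Z i 0) := by
      refine Matrix.ext fun i k => ?_
      simp only [Matrix.add_apply, mul_apply, of_apply, transpose_apply, vecMulVec_apply,
        Fin.sum_univ_succ]
      ring
    have hmeas : Measurable fun p : (Fin m → ℝ) × (Fin m → Fin n → ℝ) =>
        ENNReal.ofReal (det (1 + of p.2 * (of p.2)ᵀ + vecMulVec p.1 p.1) ^ (-a)) := by
      have hof : Continuous fun p : (Fin m → ℝ) × (Fin m → Fin n → ℝ) => of p.2 := continuous_snd
      have hc : Continuous fun p : (Fin m → ℝ) × (Fin m → Fin n → ℝ) =>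
          det (1 + of p.2 * (of p.2)ᵀ + vecMulVec p.1 p.1) :=
        ((continuous_const.add (hof.matrix_mul hof.matrix_transpose)).add
          (continuous_fst.matrix_vecMulVec continuous_fst)).matrix_det
      have := hc.measurable
      fun_prop
    have hpos (W : Fin m → Fin n → ℝ) : (1 + of W * (of W)ᵀ).PosDef := by
      have := posSemidef_self_mul_conjTranspose (of W)
      rw [conjTranspose_eq_transpose_of_trivial] at this
      exact PosDef.one.add_posSemidef this
    have hcard : (Fintype.card (Fin m) : ℝ) / 2 < a := by
      rw [Fintype.card_fin, ha]; linarith [(n.cast_nonneg : (0 : ℝ) ≤ n)]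
    rw [hexp]
    simp only [hsplit]
    rw [(measurePreserving_splitFirstColumn m n).lintegral_comp hmeas, Measure.volume_eq_prod,
      lintegral_prod_symm _ hmeas.aemeasurable]
    simp only [lintegral_det_add_vecMulVec_self_rpow (hpos _) hcard]
    rw [lintegral_const_mul' _ _ ENNReal.ofReal_ne_top,
      show -(a - 1 / 2) = -((m : ℝ) + n) / 2 by rw [ha]; ring, ih, Fintype.card_fin,
      show a - (m : ℝ) / 2 = ((n : ℝ) + 1) / 2 by rw [ha]; ring, ← ENNReal.ofReal_mul,
      Finset.prod_range_succ, show (m * ((n + 1 : ℕ) : ℝ)) / 2 = (m : ℝ) / 2 + (m * n : ℝ) / 2 by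
        push_cast; ring, Real.rpow_add Real.pi_pos]
    · congr 1
      ring
    · have h₁ : 0 ≤ Real.Gamma (((n : ℝ) + 1) / 2) := Real.Gamma_nonneg_of_nonneg (by positivity)
      have h₂ : 0 ≤ Real.Gamma a := Real.Gamma_nonneg_of_nonneg (by positivity)
      positivity

/-- Selberg-type integral:
`∫ det(1 + Z Zᵀ)^(-(m+n)/2) dZ = π^(mn/2) ∏_{j=1}^n Γ(j/2)/Γ((m+j)/2)`. -/
theorem selberg_type_integral (m n : ℕ) (hm : 1 ≤ m) (hn : 1 ≤ n) :
    (∫⁻ Z : Fin m → Fin n → ℝ,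
        ENNReal.ofReal
          (Matrix.det (1 + Matrix.of Z * (Matrix.of Z)ᵀ) ^ (-((m : ℝ) + n) / 2)))
      = ENNReal.ofReal (Real.pi ^ ((m * n : ℝ) / 2) *
          ∏ j ∈ Finset.range n,
            Real.Gamma (((j + 1) : ℝ) / 2) / Real.Gamma ((m + (j + 1) : ℝ) / 2)) :=
  lintegral_det_one_add_mul_transpose_rpow m n
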